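/- arXiv:1408.1468 — 8 statements merged into one kernel-verified Lean document; each statement's English description precedes it below -/
import Mathlib

section
/- Let r > 0 and r_u ≥ 0 with r ≠ r_u. Then (1/(2π)) ∫_{−π}^{π} (r² + r_u² − 2 r r_u cos α)^{−2} dα = (r² + r_u²) / |r² − r_u²|³. -/
open Real

lemma aux_6 (r s : ℝ) (hs : 0 ≤ s) (h : s < r) :
    (1 / (2 * π)) * ∫ α in (-π)..π, ((r ^ 2 + s ^ 2 - 2 * r * s * Real.cos α) ^ 2)⁻¹ =
      (r ^ 2 + s ^ 2) / (r ^ 2 - s ^ 2) ^ 3 := by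
  have hk : 0 < r ^ 2 - s ^ 2 := by nlinarith
  have hm : ∀ x : ℝ, 0 < r - s * Real.cos x := fun x => by
    nlinarith [Real.cos_le_one x]
  have hD : ∀ x : ℝ, 0 < r ^ 2 + s ^ 2 - 2 * r * s * Real.cos x := fun x => by
    nlinarith [Real.cos_sq_add_sin_sq x, sq_nonneg (s * Real.sin x), pow_pos (hm x) 2]
  have key : ∀ x ∈ Set.uIcc (-π) π, HasDerivAt (fun x : ℝ =>
      ((r ^ 2 + s ^ 2) / (r ^ 2 - s ^ 2) *
        (x + 2 * Real.arctan (s * Real.sin x / (r - s * Real.cos x))) +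
        2 * r * s * (Real.sin x / (r ^ 2 + s ^ 2 - 2 * r * s * Real.cos x))) / (r ^ 2 - s ^ 2) ^ 2)
      (((r ^ 2 + s ^ 2 - 2 * r * s * Real.cos x) ^ 2)⁻¹) x := by
    intro x _
    have h1 : HasDerivAt (fun x : ℝ => r - s * Real.cos x) (s * Real.sin x) x := by
      simpa using ((Real.hasDerivAt_cos x).const_mul s).const_sub r
    have h2 : HasDerivAt (fun x : ℝ => r ^ 2 + s ^ 2 - 2 * r * s * Real.cos x)
        (2 * r * s * Real.sin x) x := by
      simpa using ((Real.hasDerivAt_cos x).const_mul (2 * r * s)).const_sub (r ^ 2 + s ^ 2)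
    have h3 := (((Real.hasDerivAt_sin x).const_mul s).fun_div h1 (hm x).ne').arctan
    have h4 := (Real.hasDerivAt_sin x).fun_div h2 (hD x).ne'
    have h3' : 1 / (1 + (s * Real.sin x / (r - s * Real.cos x)) ^ 2) *
        ((s * Real.cos x * (r - s * Real.cos x) - s * Real.sin x * (s * Real.sin x)) /
          (r - s * Real.cos x) ^ 2) =
        (s * r * Real.cos x - s ^ 2) / (r ^ 2 + s ^ 2 - 2 * r * s * Real.cos x) := by
      have e : 1 + (s * Real.sin x / (r - s * Real.cos x)) ^ 2 =
          (r ^ 2 + s ^ 2 - 2 * r * s * Real.cos x) / (r - s * Real.cos x) ^ 2 := by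
        have := (hm x).ne'
        field_simp
        linear_combination s ^ 2 * Real.cos_sq_add_sin_sq x
      have e2 : s * Real.cos x * (r - s * Real.cos x) - s * Real.sin x * (s * Real.sin x)
          = s * r * Real.cos x - s ^ 2 := by
        linear_combination -s ^ 2 * Real.cos_sq_add_sin_sq x
      rw [e, e2]
      have := (hm x).ne'
      have := (hD x).ne'
      field_simp
    rw [h3'] at h3
    have h5 := ((((hasDerivAt_id x).add (h3.const_mul 2)).const_mul
      ((r ^ 2 + s ^ 2) / (r ^ 2 - s ^ 2))).add (h4.const_mul (2 * r * s))).div_const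
        ((r ^ 2 - s ^ 2) ^ 2)
    refine h5.congr_deriv ?_
    have e3 : Real.cos x * (r ^ 2 + s ^ 2 - 2 * r * s * Real.cos x) -
        Real.sin x * (2 * r * s * Real.sin x) = (r ^ 2 + s ^ 2) * Real.cos x - 2 * r * s := by
      linear_combination -2 * r * s * Real.cos_sq_add_sin_sq x
    rw [e3]
    have d0 := (hD x).ne'
    have k0 := hk.ne'
    clear h5 h4 h3 h3' e3 h1 h2
    generalize Real.cos x = c at *
    obtain ⟨D, hDe⟩ : ∃ D, D = r ^ 2 + s ^ 2 - 2 * r * s * c := ⟨_, rfl⟩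
    rw [← hDe] at d0 ⊢
    field_simp
    rw [hDe]
    ring
  rw [intervalIntegral.integral_eq_sub_of_hasDerivAt key]
  · have := hk.ne'
    have := Real.pi_ne_zero
    simp
    field_simp
    ring
  · apply Continuous.intervalIntegrable
    exact Continuous.inv₀ (by fun_prop) fun x => (pow_pos (hD x) 2).ne'

/-- Theorem 3, closed form for path-loss exponent `v = 4`:
`(1/(2π)) ∫_{−π}^{π} (r² + r_u² − 2 r r_u cos α)⁻² dα = (r² + r_u²)/|r² − r_u²|³`. -/
theorem stmt_6 (r ru : ℝ) (hr : 0 < r) (hru : 0 ≤ ru) (hne : r ≠ ru) :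
    (1 / (2 * π)) * ∫ α in (-π)..π, ((r ^ 2 + ru ^ 2 - 2 * r * ru * Real.cos α) ^ 2)⁻¹ =
      (r ^ 2 + ru ^ 2) / |r ^ 2 - ru ^ 2| ^ 3 := by
  rcases lt_or_gt_of_ne hne with h | h
  · rw [abs_of_neg (by nlinarith), neg_sub, add_comm (r ^ 2), mul_right_comm 2 r ru]
    exact aux_6 ru r hr.le h
  · rw [abs_of_pos (by nlinarith)]
    exact aux_6 r ru hru h
end

section
/- Let r > 0 and r_u ≥ 0 with r ≠ r_u. Then (1/(2π)) ∫_{−π}^{π} (r² + r_u² − 2 r r_u cos α)^{−3} dα = (3 (r² + r_u²)² − (r² − r_u²)²) / (2 |r² − r_u²|⁵). -/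
open Real

lemma aux_pos (M m x : ℝ) (hm : 0 ≤ m) (h : m < M) : 0 < M ^ 2 + m ^ 2 - 2 * M * m * cos x := by
  have h1 := cos_le_one x
  have h2 : 0 ≤ M * m := mul_nonneg (by linarith) hm
  nlinarith [mul_nonneg h2 (sub_nonneg.2 h1), pow_pos (sub_pos.2 h) 2]

lemma aux_deriv (M m x : ℝ) (hm : 0 ≤ m) (h : m < M) :
    HasDerivAt (fun x => 1 / (2 * (M ^ 2 - m ^ 2) ^ 2) *
      (2 * M * m * (sin x / (M ^ 2 + m ^ 2 - 2 * M * m * cos x) ^ 2)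
        + 3 * (M ^ 2 + m ^ 2) / (M ^ 2 - m ^ 2) ^ 2 *
          (2 * M * m * (sin x / (M ^ 2 + m ^ 2 - 2 * M * m * cos x)))
        + (3 * (M ^ 2 + m ^ 2) ^ 2 / (M ^ 2 - m ^ 2) ^ 2 - 1) / (M ^ 2 - m ^ 2) *
          (x + 2 * arctan (m * sin x / (M - m * cos x)))))
      (((M ^ 2 + m ^ 2 - 2 * M * m * cos x) ^ 3)⁻¹) x := by
  have hu := (aux_pos M m x hm h)
  have hu0 := hu.ne'
  have hs : M ^ 2 - m ^ 2 ≠ 0 := by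
    have : 0 < (M - m) * (M + m) := mul_pos (by linarith) (by linarith)
    nlinarith
  have hw : M - m * cos x ≠ 0 := by
    have := mul_nonneg hm (sub_nonneg.2 (cos_le_one x))
    nlinarith
  have hsc := sin_sq_add_cos_sq x
  have dU : HasDerivAt (fun x => M ^ 2 + m ^ 2 - 2 * M * m * cos x) (2 * M * m * sin x) x := by
    refine HasDerivAt.congr_deriv (((hasDerivAt_cos x).const_mul (2 * M * m)).const_sub (M ^ 2 + m ^ 2)) (Eq.symm ?_)
    ring
  have dW : HasDerivAt (fun x => M - m * cos x) (m * sin x) x := by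
    refine HasDerivAt.congr_deriv (((hasDerivAt_cos x).const_mul m).const_sub M) (Eq.symm ?_)
    ring
  have d1 : HasDerivAt (fun x => 2 * M * m * (sin x / (M ^ 2 + m ^ 2 - 2 * M * m * cos x)))
      ((M ^ 2 - m ^ 2) ^ 2 / (M ^ 2 + m ^ 2 - 2 * M * m * cos x) ^ 2
        - (M ^ 2 + m ^ 2) / (M ^ 2 + m ^ 2 - 2 * M * m * cos x)) x := by
    refine HasDerivAt.congr_deriv (((hasDerivAt_sin x).div dU hu0).const_mul (2 * M * m)) (Eq.symm ?_)
    rw [div_sub_div _ _ (pow_ne_zero 2 hu0) hu0, mul_div_assoc', div_eq_div_iff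
      (mul_ne_zero (pow_ne_zero 2 hu0) hu0) (pow_ne_zero 2 hu0)]
    linear_combination (M ^ 2 + m ^ 2 - 2 * M * m * cos x) ^ 3 * (4 * M ^ 2 * m ^ 2) * hsc
  have d2 : HasDerivAt (fun x => 2 * M * m * (sin x / (M ^ 2 + m ^ 2 - 2 * M * m * cos x) ^ 2))
      (2 * (M ^ 2 - m ^ 2) ^ 2 / (M ^ 2 + m ^ 2 - 2 * M * m * cos x) ^ 3
        - 3 * (M ^ 2 + m ^ 2) / (M ^ 2 + m ^ 2 - 2 * M * m * cos x) ^ 2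
        + 1 / (M ^ 2 + m ^ 2 - 2 * M * m * cos x)) x := by
    refine HasDerivAt.congr_deriv (((hasDerivAt_sin x).div (dU.pow 2) (pow_ne_zero 2 hu0)).const_mul (2 * M * m)) (Eq.symm ?_)
    simp only [Pi.pow_apply]
    field_simp
    push_cast
    linear_combination (M ^ 2 + m ^ 2 - 2 * M * m * cos x) * (8 * M ^ 2 * m ^ 2) * hsc
  have d3 : HasDerivAt (fun x => x + 2 * arctan (m * sin x / (M - m * cos x)))
      ((M ^ 2 - m ^ 2) / (M ^ 2 + m ^ 2 - 2 * M * m * cos x)) x := by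
    refine HasDerivAt.congr_deriv ((hasDerivAt_id x).add
      ((((hasDerivAt_sin x).const_mul m).div dW hw).arctan.const_mul 2)) (Eq.symm ?_)
    have e : 1 + (m * sin x / (M - m * cos x)) ^ 2 =
        (M ^ 2 + m ^ 2 - 2 * M * m * cos x) / (M - m * cos x) ^ 2 := by
      field_simp
      linear_combination m ^ 2 * hsc
    simp only [Pi.div_apply]
    rw [e]
    have e2 : ∀ u w y : ℝ, u ≠ 0 → w ≠ 0 → 1 + 2 * (1 / (u / w ^ 2) * (y / w ^ 2)) =
        (u + 2 * y) / u := by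
      intro u w y h1 h2
      field_simp
    rw [e2 _ _ _ hu0 hw]
    congr 1
    linear_combination (2 * m ^ 2) * hsc
  refine HasDerivAt.congr_deriv (((d2.add (d1.const_mul (3 * (M ^ 2 + m ^ 2) / (M ^ 2 - m ^ 2) ^ 2))).add
    (d3.const_mul ((3 * (M ^ 2 + m ^ 2) ^ 2 / (M ^ 2 - m ^ 2) ^ 2 - 1) / (M ^ 2 - m ^ 2)))).const_mul
    (1 / (2 * (M ^ 2 - m ^ 2) ^ 2))) (Eq.symm ?_)
  generalize M ^ 2 + m ^ 2 - 2 * M * m * cos x = u at *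
  generalize M ^ 2 - m ^ 2 = s at *
  field_simp
  ring

lemma aux_main (M m : ℝ) (hm : 0 ≤ m) (h : m < M) :
    (1 / (2 * π)) * ∫ α in (-π)..π, ((M ^ 2 + m ^ 2 - 2 * M * m * Real.cos α) ^ 3)⁻¹ =
      (3 * (M ^ 2 + m ^ 2) ^ 2 - (M ^ 2 - m ^ 2) ^ 2) / (2 * |M ^ 2 - m ^ 2| ^ 5) := by
  have hs : 0 < M ^ 2 - m ^ 2 := by
    have : 0 < (M - m) * (M + m) := mul_pos (by linarith) (by linarith)
    nlinarith
  rw [intervalIntegral.integral_eq_sub_of_hasDerivAt (fun x _ => aux_deriv M m x hm h)]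
  · rw [abs_of_pos hs]
    simp only [sin_pi, sin_neg, neg_zero, mul_zero, zero_div, arctan_zero, add_zero, zero_add]
    have := pi_pos.ne'
    have := hs.ne'
    generalize M ^ 2 - m ^ 2 = s at *
    field_simp
    ring
  · apply Continuous.intervalIntegrable
    refine Continuous.inv₀ (by fun_prop) fun x => (pow_pos (aux_pos M m x hm h) 3).ne'

/-- Theorem 3, closed form for path-loss exponent `v = 6`:
`(1/(2π)) ∫_{−π}^{π} (r² + r_u² − 2 r r_u cos α)⁻³ dα
  = (3(r² + r_u²)² − (r² − r_u²)²)/(2 |r² − r_u²|⁵)`. -/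
theorem stmt_7 (r ru : ℝ) (hr : 0 < r) (hru : 0 ≤ ru) (hne : r ≠ ru) :
    (1 / (2 * π)) * ∫ α in (-π)..π, ((r ^ 2 + ru ^ 2 - 2 * r * ru * Real.cos α) ^ 3)⁻¹ =
      (3 * (r ^ 2 + ru ^ 2) ^ 2 - (r ^ 2 - ru ^ 2) ^ 2) / (2 * |r ^ 2 - ru ^ 2| ^ 5) := by
  rcases lt_or_gt_of_ne hne with h | h
  · have := aux_main ru r hr.le h
    rw [abs_sub_comm (r ^ 2), add_comm (r ^ 2), mul_right_comm 2 r ru,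
      show (r ^ 2 - ru ^ 2) ^ 2 = (ru ^ 2 - r ^ 2) ^ 2 by ring]
    exact this
  · exact aux_main r ru hru h
end

section
/- Let r > 0, r_u ≥ 0 with r ≠ r_u, and let v be a real number. Set z = (r² + r_u²) / |r² − r_u²| (so z ≥ 1). Then (1/(2π)) ∫_{−π}^{π} (r² + r_u² − 2 r r_u cos α)^{−v/2} dα = |r² − r_u²|^{−v/2} · (1/π) ∫_{0}^{π} (z + √(z² − 1) cos φ)^{v/2 − 1} dφ. -/
open Real

lemma legendre_aux (z s p : ℝ) (hz : 0 < z) (hs : 0 ≤ s) (h : z ^ 2 - s ^ 2 = 1) :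
    ∫ α in (0 : ℝ)..π, (z - s * Real.cos α) ^ (-p) =
      ∫ φ in (0 : ℝ)..π, (z + s * Real.cos φ) ^ (p - 1) := by
  have hsz : s < z := by nlinarith
  have hpos : ∀ x, 0 < z + s * Real.cos x := fun x => by
    nlinarith [Real.neg_one_le_cos x]
  have hpos' : ∀ x, 0 < z - s * Real.cos x := fun x => by
    nlinarith [Real.cos_le_one x]
  set u : ℝ → ℝ := fun x => (s + z * Real.cos x) / (z + s * Real.cos x) with hu
  have hu1 : ∀ x, 1 - u x ^ 2 = (Real.sin x / (z + s * Real.cos x)) ^ 2 := by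
    intro x
    have := (hpos x).ne'
    have h2 := Real.sin_sq_add_cos_sq x
    simp only [hu]
    field_simp
    linear_combination (1 - Real.cos x ^ 2) * h - h2
  have hub : ∀ x, -1 ≤ u x ∧ u x ≤ 1 := by
    intro x
    have h1 := hu1 x
    have h2 := sq_nonneg (Real.sin x / (z + s * Real.cos x))
    constructor <;> nlinarith
  have hucont : Continuous u := by
    refine Continuous.div (by fun_prop) (by fun_prop) fun x => (hpos x).ne'
  have hder : ∀ x ∈ Set.Ioo (min 0 π) (max 0 π),
      HasDerivWithinAt (fun x => Real.arccos (u x)) ((z + s * Real.cos x)⁻¹) (Set.Ioi x) x := by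
    intro x hx
    rw [min_eq_left pi_pos.le, max_eq_right pi_pos.le] at hx
    have hsin := Real.sin_pos_of_pos_of_lt_pi hx.1 hx.2
    have hp := hpos x
    have hq : 0 < Real.sin x / (z + s * Real.cos x) := by positivity
    have hlt : 0 < 1 - u x ^ 2 := by rw [hu1]; positivity
    have hd : HasDerivAt u (-Real.sin x / (z + s * Real.cos x) ^ 2) x := by
      have h1 := (((Real.hasDerivAt_cos x).const_mul z).const_add s).div
        (((Real.hasDerivAt_cos x).const_mul s).const_add z) hp.ne'
      refine h1.congr_deriv ?_
      congr 1
      linear_combination (-Real.sin x) * h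
    have h3 := (Real.hasDerivAt_arccos (x := u x) (by nlinarith) (by nlinarith)).comp x hd
    rw [hu1, Real.sqrt_sq hq.le] at h3
    refine HasDerivAt.hasDerivWithinAt ?_
    refine h3.congr_deriv ?_
    field_simp
  have key := intervalIntegral.integral_comp_mul_deriv'' (a := 0) (b := π)
    (f := fun x => Real.arccos (u x)) (f' := fun x => (z + s * Real.cos x)⁻¹)
    (g := fun α => (z - s * Real.cos α) ^ (-p))
    (Real.continuous_arccos.comp hucont).continuousOn hder
    (Continuous.continuousOn (Continuous.inv₀ (by fun_prop) fun x => (hpos x).ne'))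
    (Continuous.continuousOn (Continuous.rpow_const (by fun_prop) fun x => Or.inl (hpos' x).ne'))
  have e0 : Real.arccos (u 0) = 0 := by
    have : u 0 = 1 := by
      simp only [hu, Real.cos_zero]
      rw [div_eq_one_iff_eq] <;> linarith
    rw [this, Real.arccos_one]
  have e1 : Real.arccos (u π) = π := by
    have : u π = -1 := by
      simp only [hu, Real.cos_pi]
      rw [div_eq_iff] <;> linarith
    rw [this, Real.arccos_neg_one]
  simp only [e0, e1] at key
  rw [← key]
  refine intervalIntegral.integral_congr fun x _ => ?_
  have hp := hpos x
  simp only [Function.comp]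
  rw [Real.cos_arccos (hub x).1 (hub x).2]
  have : z - s * u x = (z + s * Real.cos x)⁻¹ := by
    simp only [hu]
    field_simp
    linear_combination h
  rw [this, Real.inv_rpow hp.le, Real.rpow_neg hp.le, inv_inv, Real.rpow_sub_one hp.ne',
    div_eq_mul_inv]

/-- Appendix C, Eq. (49): the asymptotic mean path-loss equals
`|r² − r_u²|^{−v/2}` times the Laplace integral representation of the Legendre
function `P_{v/2−1}(z)` with `z = (r² + r_u²)/|r² − r_u²|`. -/
theorem stmt_8 (r ru v : ℝ) (hr : 0 < r) (hru : 0 ≤ ru) (hne : r ≠ ru)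
    (z : ℝ) (hz : z = (r ^ 2 + ru ^ 2) / |r ^ 2 - ru ^ 2|) :
    (1 / (2 * π)) *
        ∫ α in (-π)..π, (r ^ 2 + ru ^ 2 - 2 * r * ru * Real.cos α) ^ (-(v / 2)) =
      |r ^ 2 - ru ^ 2| ^ (-(v / 2)) *
        ((1 / π) *
          ∫ φ in (0 : ℝ)..π,
            (z + Real.sqrt (z ^ 2 - 1) * Real.cos φ) ^ (v / 2 - 1)) := by
  have hD0 : r ^ 2 - ru ^ 2 ≠ 0 := by
    intro h
    have : (r - ru) * (r + ru) = 0 := by linarith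
    rcases mul_eq_zero.1 this with h | h
    · exact hne (by linarith)
    · linarith
  have hD : 0 < |r ^ 2 - ru ^ 2| := abs_pos.2 hD0
  have hDsq : |r ^ 2 - ru ^ 2| ^ 2 = (r ^ 2 - ru ^ 2) ^ 2 := sq_abs _
  set D := |r ^ 2 - ru ^ 2| with hDdef
  have hz0 : 0 < z := by rw [hz]; positivity
  have hs : z ^ 2 - 1 = (2 * r * ru / D) ^ 2 := by
    rw [hz]; field_simp; rw [hDsq]; ring
  have hs0 : 0 ≤ 2 * r * ru / D := by positivity
  rw [hs, Real.sqrt_sq hs0, ← legendre_aux z _ (v / 2) hz0 hs0 (by linarith)]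
  have hfac : ∀ α, (r ^ 2 + ru ^ 2 - 2 * r * ru * Real.cos α) ^ (-(v / 2)) =
      D ^ (-(v / 2)) * (z - 2 * r * ru / D * Real.cos α) ^ (-(v / 2)) := by
    intro α
    have e : r ^ 2 + ru ^ 2 - 2 * r * ru * Real.cos α =
        D * (z - 2 * r * ru / D * Real.cos α) := by
      rw [hz]; field_simp
    have hn : 0 ≤ r ^ 2 + ru ^ 2 - 2 * r * ru * Real.cos α := by
      have : 0 ≤ r * ru := by positivity
      nlinarith [Real.cos_le_one α, sq_nonneg (r - ru)]
    rw [e] at hn ⊢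
    exact Real.mul_rpow hD.le (nonneg_of_mul_nonneg_right hn hD)
  simp only [hfac]
  rw [intervalIntegral.integral_const_mul]
  set g : ℝ → ℝ := fun α => (z - 2 * r * ru / D * Real.cos α) ^ (-(v / 2)) with hg
  have hpos' : ∀ x, z - 2 * r * ru / D * Real.cos x ≠ 0 := fun x => by
    have : 2 * r * ru / D < z := by nlinarith
    nlinarith [Real.cos_le_one x]
  have hgc : Continuous g :=
    Continuous.rpow_const (by fun_prop) fun x => Or.inl (hpos' x)
  have hsplit : ∫ α in (-π)..π, g α = 2 * ∫ α in (0 : ℝ)..π, g α := by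
    rw [← intervalIntegral.integral_add_adjacent_intervals (hgc.intervalIntegrable (-π) 0)
      (hgc.intervalIntegrable 0 π)]
    have := intervalIntegral.integral_comp_neg (a := 0) (b := π) g
    have h2 : ∀ x, g (-x) = g x := fun x => by simp only [hg, Real.cos_neg]
    simp only [h2, neg_zero] at this
    rw [← this]; ring
  rw [hsplit]
  field_simp
end

section
/- Let z ≥ 1, define I(a, z) = (1/π) ∫_{0}^{π} (z + √(z² − 1) cos φ)^a dφ and c(a) = 2^{3a} Γ(a + 1/2)² / (π Γ(2a + 1)). If 0 ≤ a ≤ 1, then I(a, z) ≥ c(a) z^a. If 1 ≤ a ≤ 2, then I(a, z) ≤ c(a) z^a. -/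
open Real

lemma beta_real_aux (a : ℝ) (ha : 0 ≤ a) :
    ∫ x in Set.Ioo (0:ℝ) 1, x ^ (a - 1/2) * (1 - x) ^ (-(1/2) : ℝ) =
      Real.Gamma (a + 1/2) * √π / Real.Gamma (a + 1) := by
  have h := ProbabilityTheory.beta_eq_betaIntegralReal (a + 1/2) (1/2) (by linarith) (by norm_num)
  rw [ProbabilityTheory.beta, Real.Gamma_one_half_eq,
    show a + 1/2 + 1/2 = a + 1 by ring] at h
  rw [h, Complex.betaIntegral, intervalIntegral.integral_of_le zero_le_one,
    MeasureTheory.integral_Ioc_eq_integral_Ioo]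
  have h2 : ∫ x in Set.Ioo (0:ℝ) 1, (x:ℂ) ^ (((a + 1/2 : ℝ) : ℂ) - 1) *
        (1 - (x:ℂ)) ^ (((1/2 : ℝ) : ℂ) - 1) =
      ∫ x in Set.Ioo (0:ℝ) 1, ((x ^ (a - 1/2) * (1 - x) ^ (-(1/2) : ℝ) : ℝ) : ℂ) := by
    apply MeasureTheory.setIntegral_congr_fun measurableSet_Ioo
    intro x hx
    have h1 : (0:ℝ) ≤ x := hx.1.le
    have h3 : (0:ℝ) ≤ 1 - x := by linarith [hx.2]
    simp only []
    rw [Complex.ofReal_mul, Complex.ofReal_cpow h1, Complex.ofReal_cpow h3]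
    congr 2 <;> push_cast <;> ring
  rw [h2, integral_complex_ofReal, Complex.ofReal_re]

lemma image_aux : (fun φ : ℝ => (1 + cos φ) / 2) '' Set.Ioo 0 π = Set.Ioo 0 1 := by
  ext x
  constructor
  · rintro ⟨φ, hφ, rfl⟩
    have hs := Real.sin_pos_of_mem_Ioo hφ
    have := Real.sin_sq_add_cos_sq φ
    constructor <;> simp only [] <;> nlinarith
  · rintro ⟨h0, h1⟩
    refine ⟨arccos (2 * x - 1), ⟨?_, ?_⟩, ?_⟩
    · rw [Real.arccos_pos]; linarith
    · refine lt_of_le_of_ne (Real.arccos_le_pi _) ?_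
      intro h
      rw [Real.arccos_eq_pi] at h
      linarith
    · simp only []
      rw [Real.cos_arccos (by linarith) (by linarith)]; ring

lemma integral_aux (a : ℝ) (ha : 0 ≤ a) :
    ∫ φ in (0:ℝ)..π, ((1 + cos φ) / 2) ^ a =
      Real.Gamma (a + 1/2) * √π / Real.Gamma (a + 1) := by
  rw [← beta_real_aux a ha, ← image_aux,
    MeasureTheory.integral_image_eq_integral_abs_deriv_smul (f' := fun φ => - sin φ / 2)
      measurableSet_Ioo, intervalIntegral.integral_of_le pi_pos.le,
    MeasureTheory.integral_Ioc_eq_integral_Ioo]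
  · apply MeasureTheory.setIntegral_congr_fun measurableSet_Ioo
    intro φ hφ
    have hs := Real.sin_pos_of_mem_Ioo hφ
    have h1 := Real.sin_sq_add_cos_sq φ
    have hx : 0 < (1 + cos φ) / 2 := by nlinarith
    have hy : 0 < (1 - cos φ) / 2 := by nlinarith
    simp only [smul_eq_mul]
    rw [show 1 - (1 + cos φ) / 2 = (1 - cos φ) / 2 by ring,
      show a - 1/2 = a + (-(1/2)) by ring, Real.rpow_add hx, mul_assoc,
      ← Real.mul_rpow hx.le hy.le,
      show (1 + cos φ) / 2 * ((1 - cos φ) / 2) = (sin φ / 2) ^ 2 by nlinarith,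
      Real.rpow_neg (by positivity), ← Real.sqrt_eq_rpow, Real.sqrt_sq (by positivity),
      neg_div, abs_neg, abs_of_pos (by positivity)]
    field_simp
  · intro x _
    apply HasDerivAt.hasDerivWithinAt
    exact ((Real.hasDerivAt_cos x).const_add 1).div_const 2
  · intro x hx y hy hxy
    simp only [] at hxy
    exact Real.injOn_cos ⟨hx.1.le, hx.2.le⟩ ⟨hy.1.le, hy.2.le⟩ (by linarith)

lemma c_aux (a : ℝ) (ha : 0 ≤ a) :
    π * (2 ^ (3 * a) * Real.Gamma (a + 1 / 2) ^ 2 / (π * Real.Gamma (2 * a + 1))) =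
      ∫ φ in (0:ℝ)..π, (1 + cos φ) ^ a := by
  have h1 : ∫ φ in (0:ℝ)..π, (1 + cos φ) ^ a =
      2 ^ a * ∫ φ in (0:ℝ)..π, ((1 + cos φ) / 2) ^ a := by
    rw [← intervalIntegral.integral_const_mul]
    congr 1
    ext φ
    rw [← Real.mul_rpow (by norm_num) (by linarith [Real.neg_one_le_cos φ])]
    congr 1; ring
  rw [h1, integral_aux a ha]
  have h2 := Real.Gamma_mul_Gamma_add_half (a + 1/2)
  rw [show a + 1/2 + 1/2 = a + 1 by ring, show 2 * (a + 1/2) = 2 * a + 1 by ring,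
    show 1 - (2 * a + 1) = -(2 * a) by ring, Real.rpow_neg (by norm_num)] at h2
  have g1 := Real.Gamma_pos_of_pos (show 0 < a + 1/2 by linarith)
  have g2 := Real.Gamma_pos_of_pos (show 0 < a + 1 by linarith)
  have g3 := Real.Gamma_pos_of_pos (show 0 < 2 * a + 1 by linarith)
  have hp := pi_pos
  have e : (2:ℝ) ^ (3 * a) = 2 ^ a * 2 ^ (2 * a) := by
    rw [← Real.rpow_add (by norm_num)]; congr 1; ring
  have hq : (0:ℝ) < 2 ^ (2 * a) := by positivity
  rw [e]
  generalize (2:ℝ) ^ (2 * a) = q at *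
  generalize (2:ℝ) ^ a = p at *
  generalize Real.Gamma (a + 1/2) = A at *
  generalize Real.Gamma (a + 1) = B at *
  generalize Real.Gamma (2 * a + 1) = C at *
  field_simp at h2 ⊢
  linear_combination p * h2

lemma symm_aux (a : ℝ) :
    ∫ φ in (0:ℝ)..π, (1 - cos φ) ^ a = ∫ φ in (0:ℝ)..π, (1 + cos φ) ^ a := by
  have := intervalIntegral.integral_comp_sub_left (fun φ => (1 + cos φ) ^ a) π (a := 0) (b := π)
  simpa [Real.cos_pi_sub, ← sub_eq_add_neg] using this

lemma combo_aux (z a l : ℝ) (hz : 1 ≤ z) (ha : 0 ≤ a) :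
    ∫ φ in (0:ℝ)..π, (l * (z * (1 + cos φ)) ^ a + (1 - l) * (z * (1 - cos φ)) ^ a) =
      (∫ φ in (0:ℝ)..π, (1 + cos φ) ^ a) * z ^ a := by
  have hc1 : Continuous fun φ : ℝ => (z * (1 + cos φ)) ^ a :=
    (by fun_prop : Continuous fun φ : ℝ => z * (1 + cos φ)).rpow_const fun _ => Or.inr ha
  have hc2 : Continuous fun φ : ℝ => (z * (1 - cos φ)) ^ a :=
    (by fun_prop : Continuous fun φ : ℝ => z * (1 - cos φ)).rpow_const fun _ => Or.inr ha
  rw [intervalIntegral.integral_add ((hc1.const_mul l).intervalIntegrable _ _)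
    ((hc2.const_mul (1 - l)).intervalIntegrable _ _),
    intervalIntegral.integral_const_mul, intervalIntegral.integral_const_mul]
  have e1 : ∀ φ : ℝ, (z * (1 + cos φ)) ^ a = z ^ a * (1 + cos φ) ^ a := fun φ =>
    Real.mul_rpow (by linarith) (by linarith [Real.neg_one_le_cos φ])
  have e2 : ∀ φ : ℝ, (z * (1 - cos φ)) ^ a = z ^ a * (1 - cos φ) ^ a := fun φ =>
    Real.mul_rpow (by linarith) (by linarith [Real.cos_le_one φ])
  simp only [e1, e2, intervalIntegral.integral_const_mul, symm_aux]
  ring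

/-- Bounds on the Laplace integral representation `I(a,z) = (1/π)∫₀^π (z + √(z²−1)cos φ)^a dφ`
of the Legendre function in terms of `c(a) z^a` with
`c(a) = 2^{3a} Γ(a+1/2)²/(π Γ(2a+1))`: `I(a,z) ≥ c(a) z^a` for `0 ≤ a ≤ 1` and
`I(a,z) ≤ c(a) z^a` for `1 ≤ a ≤ 2`. -/
theorem stmt_11 (z : ℝ) (hz : 1 ≤ z)
    (I : ℝ → ℝ)
    (hI : ∀ a, I a = (1 / π) *
      ∫ φ in (0 : ℝ)..π, (z + Real.sqrt (z ^ 2 - 1) * Real.cos φ) ^ a)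
    (c : ℝ → ℝ)
    (hc : ∀ a, c a = 2 ^ (3 * a) * Real.Gamma (a + 1 / 2) ^ 2 /
      (π * Real.Gamma (2 * a + 1))) :
    (∀ a, 0 ≤ a → a ≤ 1 → c a * z ^ a ≤ I a) ∧
    (∀ a, 1 ≤ a → a ≤ 2 → I a ≤ c a * z ^ a) := by
  have hz0 : 0 < z := by linarith
  set s := Real.sqrt (z ^ 2 - 1) with hs
  have hs0 : 0 ≤ s := Real.sqrt_nonneg _
  have hsz : s ≤ z := by
    rw [hs]; exact Real.sqrt_le_iff.mpr ⟨hz0.le, by linarith⟩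
  have hl1 : 0 ≤ (1 + s / z) / 2 := by positivity
  have hl2 : 0 ≤ 1 - (1 + s / z) / 2 := by
    have : s / z ≤ 1 := (div_le_one hz0).mpr hsz
    linarith
  have hx : ∀ φ, z * (1 + cos φ) ∈ Set.Ici (0:ℝ) := fun φ =>
    mul_nonneg hz0.le (by linarith [Real.neg_one_le_cos φ])
  have hy : ∀ φ, z * (1 - cos φ) ∈ Set.Ici (0:ℝ) := fun φ =>
    mul_nonneg hz0.le (by linarith [Real.cos_le_one φ])
  have he : ∀ φ, (1 + s / z) / 2 * (z * (1 + cos φ)) +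
      (1 - (1 + s / z) / 2) * (z * (1 - cos φ)) = z + s * cos φ := by
    intro φ; field_simp; ring
  have hcont : ∀ a : ℝ, 0 ≤ a → Continuous fun φ : ℝ => (z + s * cos φ) ^ a := fun a ha =>
    (by fun_prop : Continuous fun φ : ℝ => z + s * cos φ).rpow_const fun _ => Or.inr ha
  have hcont2 : ∀ a : ℝ, 0 ≤ a → Continuous fun φ : ℝ => ((1 + s / z) / 2 * (z * (1 + cos φ)) ^ a +
      (1 - (1 + s / z) / 2) * (z * (1 - cos φ)) ^ a) := fun a ha =>
    (((by fun_prop : Continuous fun φ : ℝ => z * (1 + cos φ)).rpow_const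
      fun _ => Or.inr ha).const_mul _).add
    (((by fun_prop : Continuous fun φ : ℝ => z * (1 - cos φ)).rpow_const
      fun _ => Or.inr ha).const_mul _)
  have hca : ∀ a : ℝ, 0 ≤ a → c a * z ^ a = (1 / π) *
      ∫ φ in (0:ℝ)..π, ((1 + s / z) / 2 * (z * (1 + cos φ)) ^ a +
        (1 - (1 + s / z) / 2) * (z * (1 - cos φ)) ^ a) := by
    intro a ha
    rw [combo_aux z a _ hz ha, ← c_aux a ha, ← hc a]
    field_simp
  constructor
  · intro a ha0 ha1
    rw [hca a ha0, hI a]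
    refine mul_le_mul_of_nonneg_left ?_ (by positivity)
    refine intervalIntegral.integral_mono_on pi_pos.le
      ((hcont2 a ha0).intervalIntegrable _ _) ((hcont a ha0).intervalIntegrable _ _) ?_
    intro φ _
    have := (Real.concaveOn_rpow ha0 ha1).2 (hx φ) (hy φ) hl1 hl2 (by ring)
    simp only [smul_eq_mul, he] at this
    exact this
  · intro a ha1 _
    have ha0 : 0 ≤ a := by linarith
    rw [hca a ha0, hI a]
    refine mul_le_mul_of_nonneg_left ?_ (by positivity)
    refine intervalIntegral.integral_mono_on pi_pos.le
      ((hcont a ha0).intervalIntegrable _ _) ((hcont2 a ha0).intervalIntegrable _ _) ?_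
    intro φ _
    have := (convexOn_rpow ha1).2 (hx φ) (hy φ) hl1 hl2 (by ring)
    simp only [smul_eq_mul, he] at this
    exact this
end

section
/- Let 0 < r < R, C > 0, and v ∈ ℝ. Then (2/R²) ∫_{0}^{R} t · log₂( C (t² + r²)^{v/2 − 1} / |t² − r²|^{v − 1} ) dt = log₂ C + (v/2 − 1)(1 + r²/R²) log₂(R² + r²) − (v − 1)(1 − r²/R²) log₂(R² − r²) − (3v − 4)(r²/R²) log₂ r + (v/2) log₂ e. -/
open Real

lemma aux_countable (c : ℝ) : ({t : ℝ | t ^ 2 + c = 0}).Countable := by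
  apply Set.Countable.mono (s₂ := ({√(-c), -√(-c)} : Set ℝ))
  · intro t ht
    have h : t ^ 2 = -c := by
      have : t ^ 2 + c = 0 := ht
      linarith
    have h2 : |t| = √(-c) := by rw [← h, Real.sqrt_sq_eq_abs]
    rcases abs_choice t with h3 | h3
    · left; linarith
    · right
      show t = -√(-c)
      linarith
  · exact (Set.toFinite _).countable

lemma aux_integrable (c R : ℝ) :
    IntervalIntegrable (fun t : ℝ => t * Real.log (t ^ 2 + c)) MeasureTheory.volume 0 R := by
  have h : MeromorphicOn (fun t : ℝ => t ^ 2 + c) (Set.uIcc 0 R) := by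
    intro x _
    have : AnalyticAt ℝ (fun t : ℝ => t ^ 2 + c) x := by fun_prop
    exact this.meromorphicAt
  have h2 := h.intervalIntegrable_log
  exact IntervalIntegrable.continuousOn_mul h2 continuousOn_id

lemma aux_integral (c R : ℝ) :
    ∫ t in (0 : ℝ)..R, t * Real.log (t ^ 2 + c) =
      ((R ^ 2 + c) * Real.log (R ^ 2 + c) - c * Real.log c - R ^ 2) / 2 := by
  have hd := MeasureTheory.integral_eq_of_hasDerivAt_off_countable
    (fun t : ℝ => ((t ^ 2 + c) * Real.log (t ^ 2 + c) - (t ^ 2 + c)) / 2)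
    (fun t : ℝ => t * Real.log (t ^ 2 + c)) (a := 0) (b := R)
    (aux_countable c) ?_ ?_ (aux_integrable c R)
  · rw [hd]
    simp only [ne_eq, OfNat.ofNat_ne_zero, not_false_eq_true, zero_pow, zero_add]
    ring
  · have h1 : Continuous (fun t : ℝ => (t ^ 2 + c) * Real.log (t ^ 2 + c)) :=
      Real.continuous_mul_log.comp (f := fun t : ℝ => t ^ 2 + c) (by fun_prop)
    exact Continuous.continuousOn (by fun_prop)
  · intro x hx
    have hx0 : x ^ 2 + c ≠ 0 := hx.2
    have h1 : HasDerivAt (fun t : ℝ => t ^ 2 + c) (2 * x) x := by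
      simpa using (hasDerivAt_pow 2 x).add_const c
    have h2 := ((h1.mul (h1.log hx0)).sub h1).div_const 2
    refine HasDerivAt.congr_deriv h2 ?_
    rw [mul_div_cancel₀ _ hx0]
    ring

/-- Theorem 5 (derivation of `R̄^{B,1}`, Eq. (19)): exact evaluation of the average over
uniformly distributed user positions in a disk of radius `R` of the closed-form rate bound:
`(2/R²) ∫₀^R t log₂(C (t²+r²)^{v/2−1}/|t²−r²|^{v−1}) dt
  = log₂ C + (v/2−1)(1+r²/R²) log₂(R²+r²) − (v−1)(1−r²/R²) log₂(R²−r²)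
    − (3v−4)(r²/R²) log₂ r + (v/2) log₂ e`. -/
theorem stmt_15 (R r C v : ℝ) (hr : 0 < r) (hrR : r < R) (hC : 0 < C) :
    (2 / R ^ 2) *
        ∫ t in (0 : ℝ)..R,
          t * Real.logb 2 (C * (t ^ 2 + r ^ 2) ^ (v / 2 - 1) / |t ^ 2 - r ^ 2| ^ (v - 1)) =
      Real.logb 2 C
        + (v / 2 - 1) * (1 + r ^ 2 / R ^ 2) * Real.logb 2 (R ^ 2 + r ^ 2)
        - (v - 1) * (1 - r ^ 2 / R ^ 2) * Real.logb 2 (R ^ 2 - r ^ 2)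
        - (3 * v - 4) * (r ^ 2 / R ^ 2) * Real.logb 2 r
        + (v / 2) * Real.logb 2 (Real.exp 1) := by
  have hR : 0 < R := hr.trans hrR
  have hcongr : ∫ t in (0 : ℝ)..R,
      t * Real.logb 2 (C * (t ^ 2 + r ^ 2) ^ (v / 2 - 1) / |t ^ 2 - r ^ 2| ^ (v - 1)) =
      ∫ t in (0 : ℝ)..R, ((Real.log C / Real.log 2) * t
        + ((v / 2 - 1) / Real.log 2) * (t * Real.log (t ^ 2 + r ^ 2))
        - ((v - 1) / Real.log 2) * (t * Real.log (t ^ 2 + -r ^ 2))) := by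
    apply intervalIntegral.integral_congr_ae
    have hae : ∀ᵐ t : ℝ, t ∉ {t : ℝ | t ^ 2 + -r ^ 2 = 0} :=
      (aux_countable (-r ^ 2)).ae_notMem _
    filter_upwards [hae] with t ht _
    have ht0 : t ^ 2 - r ^ 2 ≠ 0 := fun h => ht (by simpa [sub_eq_add_neg] using h)
    have hp : 0 < t ^ 2 + r ^ 2 := by positivity
    have hq : 0 < |t ^ 2 - r ^ 2| := abs_pos.mpr ht0
    rw [Real.logb, Real.log_div (by positivity) (by positivity),
      Real.log_mul (by positivity) (by positivity), Real.log_rpow hp, Real.log_rpow hq,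
      Real.log_abs, ← sub_eq_add_neg]
    ring
  have i1 : IntervalIntegrable (fun t : ℝ => (Real.log C / Real.log 2) * t)
      MeasureTheory.volume 0 R := Continuous.intervalIntegrable (by fun_prop) _ _
  have i2 := (aux_integrable (r ^ 2) R).const_mul ((v / 2 - 1) / Real.log 2)
  have i3 := (aux_integrable (-r ^ 2) R).const_mul ((v - 1) / Real.log 2)
  rw [hcongr, intervalIntegral.integral_sub (i1.add i2) i3, intervalIntegral.integral_add i1 i2]
  have e1 : ∫ t in (0 : ℝ)..R, (Real.log C / Real.log 2) * t
      = (Real.log C / Real.log 2) * ((R ^ 2 - 0 ^ 2) / 2) := by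
    rw [← integral_id]
    exact intervalIntegral.integral_const_mul _ _
  rw [e1]
  simp only [intervalIntegral.integral_const_mul]
  rw [aux_integral, aux_integral, Real.log_neg_eq_log, Real.log_pow]
  simp only [Real.logb, Real.log_exp, ← sub_eq_add_neg]
  have hl : Real.log 2 ≠ 0 := (Real.log_pos (by norm_num)).ne'
  push_cast
  field_simp
  ring
end

section
/- Let R > 0, C > 0, and v ∈ ℝ, and define on (0, R) the function F(r) = log₂ C + (v/2 − 1)(1 + r²/R²) log₂(R² + r²) − (v − 1)(1 − r²/R²) log₂(R² − r²) − (3v − 4)(r²/R²) log₂ r + (v/2) log₂ e. Then F is differentiable on (0, R) and F′(r) = (r log₂ e / R²) [ (v − 2) ln(R²/r² + 1) + (2v − 2) ln(R²/r² − 1) ] for every r ∈ (0, R). -/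
open Real Set

/-- Eq. (23): the closed-form average-rate bound `R̄^{B,1}`, viewed as a function `F` of the
antenna-circle radius `r ∈ (0, R)`, is differentiable with
`F′(r) = (r log₂ e / R²) [(v−2) ln(R²/r² + 1) + (2v−2) ln(R²/r² − 1)]`. -/
theorem stmt_16 (R C v : ℝ) (hR : 0 < R) (hC : 0 < C)
    (F : ℝ → ℝ)
    (hF : ∀ r, F r = Real.logb 2 C
        + (v / 2 - 1) * (1 + r ^ 2 / R ^ 2) * Real.logb 2 (R ^ 2 + r ^ 2)
        - (v - 1) * (1 - r ^ 2 / R ^ 2) * Real.logb 2 (R ^ 2 - r ^ 2)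
        - (3 * v - 4) * (r ^ 2 / R ^ 2) * Real.logb 2 r
        + (v / 2) * Real.logb 2 (Real.exp 1)) :
    ∀ r ∈ Ioo (0 : ℝ) R,
      HasDerivAt F
        ((r * Real.logb 2 (Real.exp 1) / R ^ 2) *
          ((v - 2) * Real.log (R ^ 2 / r ^ 2 + 1) +
            (2 * v - 2) * Real.log (R ^ 2 / r ^ 2 - 1))) r := by
  rintro r ⟨hr, hrR⟩
  have hm : 0 < R ^ 2 - r ^ 2 := by nlinarith
  have hp : 0 < R ^ 2 + r ^ 2 := by positivity
  have h2 : Real.log 2 ≠ 0 := (Real.log_pos (by norm_num)).ne'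
  have e1 : Real.log (R ^ 2 / r ^ 2 + 1) = Real.log (R ^ 2 + r ^ 2) - 2 * Real.log r := by
    rw [show R ^ 2 / r ^ 2 + 1 = (R ^ 2 + r ^ 2) / r ^ 2 by field_simp,
      Real.log_div hp.ne' (by positivity), Real.log_pow]
    norm_num
  have e2 : Real.log (R ^ 2 / r ^ 2 - 1) = Real.log (R ^ 2 - r ^ 2) - 2 * Real.log r := by
    rw [show R ^ 2 / r ^ 2 - 1 = (R ^ 2 - r ^ 2) / r ^ 2 by field_simp,
      Real.log_div hm.ne' (by positivity), Real.log_pow]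
    norm_num
  have hq : HasDerivAt (fun x : ℝ => x ^ 2) (2 * r) r := by
    simpa using hasDerivAt_pow 2 r
  have hd := hq.div_const (R ^ 2)
  have l1 := ((hq.const_add (R ^ 2)).log hp.ne').div_const (Real.log 2)
  have l2 := ((hq.const_sub (R ^ 2)).log hm.ne').div_const (Real.log 2)
  have l3 := (Real.hasDerivAt_log hr.ne').div_const (Real.log 2)
  have key := (((((hd.const_add 1).const_mul (v / 2 - 1)).mul l1).const_add (Real.logb 2 C)).sub
    (((hd.const_sub 1).const_mul (v - 1)).mul l2)).sub ((hd.const_mul (3 * v - 4)).mul l3)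
  have key2 := key.add_const ((v / 2) * Real.logb 2 (Real.exp 1))
  have hFe : F = _ := funext hF
  rw [hFe, e1, e2]
  refine HasDerivAt.congr_deriv (f' := _) key2 ?_
  have hm' := hm.ne'
  simp only [Real.logb, Real.log_exp]
  generalize Real.log (R ^ 2 + r ^ 2) = A
  generalize Real.log (R ^ 2 - r ^ 2) = B
  generalize Real.log r = D
  field_simp
  ring
end

section
/- Let v > 2, R > 0, C > 0, and define on (0, R) the function F(r) = log₂ C + (v/2 − 1)(1 + r²/R²) log₂(R² + r²) − (v − 1)(1 − r²/R²) log₂(R² − r²) − (3v − 4)(r²/R²) log₂ r + (v/2) log₂ e. Then the equation t^{3 + 2/(v−2)} + 2 t^{2 + 2/(v−2)} − 1 = 0 has a unique solution t₀ in (0, ∞), and F attains its maximum over (0, R) uniquely at r_opt = R / √(t₀ + 1); that is, F(r) < F(r_opt) for every r ∈ (0, R) with r ≠ r_opt. -/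
open Real Set

/-- The normalized objective as a function of `x = r^2 / R^2`. -/
noncomputable def auxG (a b x : ℝ) : ℝ :=
  a * ((1 + x) * log (1 + x) - x * log x) + b * (-((1 - x) * log (1 - x)) - x * log x)

lemma gibbs_first {x y : ℝ} (hx : 0 < x) (hy : 0 < y) :
    (1 + x) * log (1 + x) - x * log x ≤ log (1 + y) + x * (log (1 + y) - log y) := by
  have h1 : log (y * (1 + x) / (x * (1 + y))) ≤ y * (1 + x) / (x * (1 + y)) - 1 :=
    log_le_sub_one_of_pos (by positivity)
  have h2 : log ((1 + x) / (1 + y)) ≤ (1 + x) / (1 + y) - 1 :=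
    log_le_sub_one_of_pos (by positivity)
  rw [log_div (by positivity) (by positivity), log_mul (by positivity) (by positivity),
    log_mul (by positivity) (by positivity)] at h1
  rw [log_div (by positivity) (by positivity)] at h2
  have h3 := mul_le_mul_of_nonneg_left h1 hx.le
  have h4 : x * (y * (1 + x) / (x * (1 + y)) - 1) + ((1 + x) / (1 + y) - 1) = 0 := by
    field_simp
    ring
  linarith

lemma gibbs_second {x y : ℝ} (hx : 0 < x) (hy : 0 < y) (hx1 : x < 1) (hy1 : y < 1)
    (hxy : x ≠ y) :
    -((1 - x) * log (1 - x)) - x * log x < -log (1 - y) + x * (log (1 - y) - log y) := by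
  have hx' : 0 < 1 - x := by linarith
  have hy' : 0 < 1 - y := by linarith
  have h1 : log (y / x) < y / x - 1 := by
    apply log_lt_sub_one_of_pos (by positivity)
    intro h
    rw [div_eq_one_iff_eq hx.ne'] at h
    exact hxy h.symm
  have h2 : log ((1 - y) / (1 - x)) ≤ (1 - y) / (1 - x) - 1 :=
    log_le_sub_one_of_pos (by positivity)
  rw [log_div (by positivity) (by positivity)] at h1 h2
  have h3 := mul_lt_mul_of_pos_left h1 hx
  have h4 := mul_le_mul_of_nonneg_left h2 hx'.le
  have h5 : x * (y / x - 1) + (1 - x) * ((1 - y) / (1 - x) - 1) = 0 := by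
    field_simp
    ring
  linarith

lemma auxG_lt {a b x y : ℝ} (ha : 0 < a) (hb : 0 < b) (hx : 0 < x) (hy : 0 < y) (hx1 : x < 1)
    (hy1 : y < 1) (hxy : x ≠ y)
    (hcrit : a * (log (1 + y) - log y) + b * (log (1 - y) - log y) = 0) :
    auxG a b x < auxG a b y := by
  unfold auxG
  have h1 := mul_le_mul_of_nonneg_left (gibbs_first hx hy) ha.le
  have h2 := mul_lt_mul_of_pos_left (gibbs_second hx hy hx1 hy1 hxy) hb
  have h3 : (x - y) * (a * (log (1 + y) - log y) + b * (log (1 - y) - log y)) = 0 := by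
    rw [hcrit, mul_zero]
  linarith

lemma F_eq {v R r : ℝ} (C : ℝ) (hR : 0 < R) (hr : r ∈ Ioo (0 : ℝ) R) :
    Real.logb 2 C
        + (v / 2 - 1) * (1 + r ^ 2 / R ^ 2) * Real.logb 2 (R ^ 2 + r ^ 2)
        - (v - 1) * (1 - r ^ 2 / R ^ 2) * Real.logb 2 (R ^ 2 - r ^ 2)
        - (3 * v - 4) * (r ^ 2 / R ^ 2) * Real.logb 2 r
        + (v / 2) * Real.logb 2 (Real.exp 1)
      = (log C - v * log R + v / 2 + auxG (v / 2 - 1) (v - 1) (r ^ 2 / R ^ 2)) / log 2 := by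
  obtain ⟨h0, h1⟩ := hr
  have hx : 0 < r ^ 2 / R ^ 2 := by positivity
  have hx1 : r ^ 2 / R ^ 2 < 1 := by
    rw [div_lt_one (by positivity)]
    exact pow_lt_pow_left₀ h1 h0.le (by norm_num)
  have hlr : log r = log (r ^ 2 / R ^ 2) / 2 + log R := by
    rw [log_div (by positivity) (by positivity), log_pow, log_pow]
    push_cast
    ring
  have e1 : log (R ^ 2 + r ^ 2) = 2 * log R + log (1 + r ^ 2 / R ^ 2) := by
    have : R ^ 2 + r ^ 2 = R ^ 2 * (1 + r ^ 2 / R ^ 2) := by field_simp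
    rw [this, log_mul (by positivity) (by positivity), log_pow]
    push_cast
    ring
  have e2 : log (R ^ 2 - r ^ 2) = 2 * log R + log (1 - r ^ 2 / R ^ 2) := by
    have : R ^ 2 - r ^ 2 = R ^ 2 * (1 - r ^ 2 / R ^ 2) := by field_simp
    rw [this, log_mul (by positivity) (by linarith), log_pow]
    push_cast
    ring
  simp only [logb]
  rw [e1, e2, hlr, log_exp]
  generalize r ^ 2 / R ^ 2 = x
  unfold auxG
  ring

/-- Lemma 6: the equation `t^{3+2/(v−2)} + 2 t^{2+2/(v−2)} − 1 = 0` has a unique positive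
solution `t₀`, and the closed-form average-rate bound `F(r) = R̄^{B,1}(r)` attains its
maximum over `(0, R)` uniquely at `r_opt = R/√(t₀+1)`. -/
theorem stmt_17 (v R C : ℝ) (hv : 2 < v) (hR : 0 < R) (hC : 0 < C)
    (F : ℝ → ℝ)
    (hF : ∀ r, F r = Real.logb 2 C
        + (v / 2 - 1) * (1 + r ^ 2 / R ^ 2) * Real.logb 2 (R ^ 2 + r ^ 2)
        - (v - 1) * (1 - r ^ 2 / R ^ 2) * Real.logb 2 (R ^ 2 - r ^ 2)
        - (3 * v - 4) * (r ^ 2 / R ^ 2) * Real.logb 2 r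
        + (v / 2) * Real.logb 2 (Real.exp 1)) :
    ∃ t₀ : ℝ, 0 < t₀ ∧
      (t₀ ^ (3 + 2 / (v - 2)) + 2 * t₀ ^ (2 + 2 / (v - 2)) - 1 = 0) ∧
      (∀ t : ℝ, 0 < t → t ^ (3 + 2 / (v - 2)) + 2 * t ^ (2 + 2 / (v - 2)) - 1 = 0 →
        t = t₀) ∧
      (∀ r ∈ Ioo (0 : ℝ) R, r ≠ R / Real.sqrt (t₀ + 1) →
        F r < F (R / Real.sqrt (t₀ + 1))) := by
  have hv2 : 0 < v - 2 := by linarith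
  set p : ℝ := 2 + 2 / (v - 2) with hp
  have hp0 : 0 < p := by positivity
  have hpow : ∀ t : ℝ, 0 < t → t ^ (3 + 2 / (v - 2)) = t ^ p * t := by
    intro t ht
    have : 3 + 2 / (v - 2) = p + 1 := by rw [hp]; ring
    rw [this, rpow_add ht, rpow_one]
  have hmono : ∀ s t : ℝ, 0 < s → s < t → s ^ p * (s + 2) < t ^ p * (t + 2) := by
    intro s t hs hst
    have h1 : s ^ p < t ^ p := rpow_lt_rpow hs.le hst hp0
    have h2 : 0 < s ^ p := rpow_pos_of_pos hs p
    exact mul_lt_mul'' h1 (by linarith) h2.le (by linarith)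
  have hcont : ContinuousOn (fun t : ℝ => t ^ p * (t + 2)) (Icc 0 1) :=
    ((continuous_id.rpow_const (fun _ => Or.inr hp0.le)).mul
      (continuous_id.add continuous_const)).continuousOn
  obtain ⟨t₀, ⟨ht0, -⟩, ht⟩ := intermediate_value_Ioo zero_le_one hcont
    (show (1 : ℝ) ∈ Ioo _ _ by
      simp only [zero_rpow hp0.ne', one_rpow]
      norm_num)
  simp only at ht
  refine ⟨t₀, ht0, ?_, ?_, ?_⟩
  · rw [hpow t₀ ht0]
    linarith
  · intro t htp h
    rw [hpow t htp] at h
    rcases lt_trichotomy t t₀ with h1 | h1 | h1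
    · have := hmono t t₀ htp h1
      linarith
    · exact h1
    · have := hmono t₀ t ht0 h1
      linarith
  · intro r hr hne
    have hs1 : 1 < √(t₀ + 1) := by
      rw [lt_sqrt (by norm_num)]
      linarith
    have hs0 : 0 < √(t₀ + 1) := by linarith
    have hr0 : R / √(t₀ + 1) ∈ Ioo (0 : ℝ) R := ⟨by positivity, div_lt_self hR hs1⟩
    rw [hF, hF, F_eq C hR hr, F_eq C hR hr0]
    have hy : (R / √(t₀ + 1)) ^ 2 / R ^ 2 = 1 / (t₀ + 1) := by
      rw [div_pow, sq_sqrt (by linarith)]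
      field_simp
    have hlt : auxG (v / 2 - 1) (v - 1) (r ^ 2 / R ^ 2)
        < auxG (v / 2 - 1) (v - 1) ((R / √(t₀ + 1)) ^ 2 / R ^ 2) := by
      have hrp := hr.1
      apply auxG_lt (by linarith) (by linarith) (by positivity) (by positivity)
      · rw [div_lt_one (by positivity)]
        exact pow_lt_pow_left₀ hr.2 hr.1.le (by norm_num)
      · rw [div_lt_one (by positivity)]
        exact pow_lt_pow_left₀ hr0.2 hr0.1.le (by norm_num)
      · intro h
        apply hne
        rw [div_left_inj' (by positivity)] at h
        exact (pow_left_inj₀ hr.1.le hr0.1.le (by norm_num)).1 h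
      · rw [hy]
        have e1 : 1 + 1 / (t₀ + 1) = (t₀ + 2) / (t₀ + 1) := by
          field_simp
          ring
        have e2 : 1 - 1 / (t₀ + 1) = t₀ / (t₀ + 1) := by
          field_simp
          ring
        rw [e1, e2, log_div (by positivity) (by positivity),
          log_div (by positivity) (by positivity), log_div (by positivity) (by positivity),
          log_one]
        have hl := congrArg log ht
        rw [log_mul (rpow_pos_of_pos ht0 p).ne' (by positivity), log_rpow ht0, log_one] at hl
        have hab : v - 1 = (v / 2 - 1) * p := by
          rw [hp]
          field_simp
          ring
        rw [hab]
        linear_combination (v / 2 - 1) * hl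
    have hlog2 : 0 < log 2 := log_pos (by norm_num)
    exact div_lt_div_of_pos_right (by linarith) hlog2
end

section
/- Let r > 0, r_u > 0 with r ≠ r_u, v > 0, and let M ≥ 2 be an even integer. Define f(α) = (r² + r_u² − 2 r r_u cos α)^{−v/2}. Then (1/M) Σ_{m=0}^{M−1} f(2πm/M) − (1/(2π)) ∫_{−π}^{π} f(α) dα ≤ (2/M) ( |r − r_u|^{−v} − (r + r_u)^{−v} ). -/
open Real

/-- Appendix B: finite-`M` error bound. For an even number `M ≥ 2` of evenly spaced
antennas, the difference between the average path-loss `(1/M) ∑_m f(2πm/M)` and the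
limiting integral `(1/(2π)) ∫_{−π}^{π} f(α) dα` is at most
`(2/M)(|r − r_u|^{−v} − (r + r_u)^{−v})`. -/
theorem stmt_19 (r ru v : ℝ) (hr : 0 < r) (hru : 0 < ru) (hne : r ≠ ru) (hv : 0 < v)
    (M : ℕ) (hM : 2 ≤ M) (hMeven : Even M)
    (f : ℝ → ℝ)
    (hf : ∀ α, f α = (r ^ 2 + ru ^ 2 - 2 * r * ru * Real.cos α) ^ (-(v / 2))) :
    (1 / (M : ℝ)) * ∑ m ∈ Finset.range M, f (2 * π * m / M) -
        (1 / (2 * π)) * ∫ α in (-π)..π, f α ≤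
      (2 / (M : ℝ)) * (|r - ru| ^ (-v) - (r + ru) ^ (-v)) := by
  obtain ⟨k, rfl⟩ := hMeven
  have hk : 0 < k := by omega
  have hkR : (0:ℝ) < k := by exact_mod_cast hk
  have hkne : (k:ℝ) ≠ 0 := hkR.ne'
  have hpi := Real.pi_pos
  have hpos : ∀ α, 0 < r ^ 2 + ru ^ 2 - 2 * r * ru * Real.cos α := by
    intro α
    have h1 : 0 < (r - ru) ^ 2 := by
      have : r - ru ≠ 0 := sub_ne_zero.mpr hne
      positivity
    nlinarith [mul_nonneg (mul_pos hr hru).le (sub_nonneg.mpr (Real.cos_le_one α))]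
  have hcont : Continuous f := by
    have : f = fun α => (r ^ 2 + ru ^ 2 - 2 * r * ru * Real.cos α) ^ (-(v / 2)) := funext hf
    rw [this]
    exact Continuous.rpow_const (by fun_prop) (fun x => Or.inl (hpos x).ne')
  have hanti : AntitoneOn f (Set.Icc 0 π) := by
    intro a ha b hb hab
    rw [hf, hf]
    apply Real.rpow_le_rpow_of_nonpos (hpos a) _ (by linarith)
    have := Real.strictAntiOn_cos.antitoneOn ha hb hab
    nlinarith [mul_le_mul_of_nonneg_left this (mul_pos hr hru).le]
  have hf0 : f 0 = |r - ru| ^ (-v) := by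
    rw [hf, Real.cos_zero, show r ^ 2 + ru ^ 2 - 2 * r * ru * 1 = |r - ru| ^ (2:ℝ) by
      rw [Real.rpow_two, sq_abs]; ring, ← Real.rpow_mul (abs_nonneg _)]
    congr 1; ring
  have hfpi : f π = (r + ru) ^ (-v) := by
    rw [hf, Real.cos_pi, show r ^ 2 + ru ^ 2 - 2 * r * ru * (-1) = (r + ru) ^ (2:ℝ) by
      rw [Real.rpow_two]; ring, ← Real.rpow_mul (by positivity)]
    congr 1; ring
  have hle : f π ≤ f 0 := hanti ⟨le_refl _, hpi.le⟩ ⟨hpi.le, le_refl _⟩ hpi.le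
  rw [← hf0, ← hfpi]
  -- the integral is twice the half integral
  have hint : ∫ α in (-π)..π, f α = 2 * ∫ α in (0:ℝ)..π, f α := by
    have h1 : ∫ α in (-π)..0, f α = ∫ α in (0:ℝ)..π, f α := by
      have h := intervalIntegral.integral_comp_neg (a := 0) (b := π) f
      rw [neg_zero] at h
      rw [← h]
      refine intervalIntegral.integral_congr (fun x _ => ?_)
      simp only [hf, Real.cos_neg]
    rw [← intervalIntegral.integral_add_adjacent_intervals (b := 0)
      (hcont.intervalIntegrable _ _) (hcont.intervalIntegrable _ _), h1]
    ring
  set g : ℕ → ℝ := fun m => f (m * (π / k)) with hg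
  have hlow : ∑ m ∈ Finset.range k, g (m + 1) ≤ (k / π) * ∫ α in (0:ℝ)..π, f α := by
    have hga : AntitoneOn (fun x : ℝ => f (x * (π / k))) (Set.Icc (0:ℝ) (0 + (k:ℕ))) := by
      have key : ∀ x ∈ Set.Icc (0:ℝ) (0 + (k:ℕ)), x * (π / k) ∈ Set.Icc 0 π := by
        intro x hx
        obtain ⟨h0, h1⟩ := hx
        refine ⟨by positivity, ?_⟩
        calc x * (π / k) ≤ k * (π / k) := by
              apply mul_le_mul_of_nonneg_right (by linarith) (by positivity)
          _ = π := by field_simp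
      intro a ha b hb hab
      exact hanti (key a ha) (key b hb) (mul_le_mul_of_nonneg_right hab (by positivity))
    have h := hga.sum_le_integral
    rw [intervalIntegral.integral_comp_mul_right f (by positivity)] at h
    have e1 : (0 + (k:ℝ)) * (π / k) = π := by field_simp; ring
    rw [e1, zero_mul, smul_eq_mul, inv_div] at h
    simpa [hg] using h
  have htel : ∑ m ∈ Finset.range k, g (m + 1) = ∑ m ∈ Finset.range k, g m + f π - f 0 := by
    have h1 := Finset.sum_range_succ g k
    have h2 := Finset.sum_range_succ' g k
    have e0 : g 0 = f 0 := by simp [hg]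
    have e1 : g k = f π := by simp only [hg]; congr 1; field_simp
    rw [e1] at h1
    rw [e0] at h2
    linarith
  have hsum : ∑ m ∈ Finset.range (k + k), f (2 * π * m / ((k + k : ℕ) : ℝ)) =
      ∑ m ∈ Finset.range k, g m + ∑ m ∈ Finset.range k, g (m + 1) := by
    rw [Finset.sum_range_add]
    congr 1
    · refine Finset.sum_congr rfl (fun m _ => ?_)
      simp only [hg]
      congr 1
      push_cast
      field_simp
      ring
    · rw [← Finset.sum_range_reflect]
      refine Finset.sum_congr rfl (fun m hm => ?_)
      have hm' : m < k := Finset.mem_range.mp hm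
      have hc : ((k - 1 - m : ℕ) : ℝ) = k - 1 - m := by
        rw [Nat.cast_sub (by omega), Nat.cast_sub (by omega)]; simp
      simp only [hg, hf]
      congr 3
      rw [← Real.cos_two_pi_sub]
      congr 1
      push_cast
      rw [hc]
      field_simp
      ring
  rw [hsum, hint]
  set I := ∫ α in (0:ℝ)..π, f α
  have hI : (∑ m ∈ Finset.range k, g (m + 1)) / k ≤ 1 / (2 * π) * (2 * I) := by
    rw [div_le_iff₀ hkR]
    calc _ ≤ _ := hlow
      _ = _ := by field_simp
  have hfin : 1 / ((k + k : ℕ) : ℝ) * (∑ m ∈ Finset.range k, g m + ∑ m ∈ Finset.range k, g (m + 1))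
      = (∑ m ∈ Finset.range k, g (m + 1)) / k + (f 0 - f π) / (2 * k) := by
    rw [htel]; push_cast; field_simp; ring
  have hr2 : 2 / ((k + k : ℕ) : ℝ) * (f 0 - f π) = 2 * ((f 0 - f π) / (2 * k)) := by
    push_cast; field_simp; ring
  have hnn : 0 ≤ (f 0 - f π) / (2 * k) := div_nonneg (by linarith) (by positivity)
  rw [hfin, hr2]
  linarith
end
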